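/- arXiv:2506.06501 — 2 statements merged into one kernel-verified Lean document; each statement's English description precedes it below -/
import Mathlib

section
/- Consider M jointly realizable linear regression tasks with data radius R > 0, and let w⋆ satisfy X_m w⋆ = y_m for all m. Fix a regularization coefficient λ > 0 and k ≥ 1, let τ be a random with-replacement ordering of length k, and let w_0, w_1, …, w_k be the regularized continual linear regression iterates with constant coefficient λ_t = λ, started from an arbitrary w_0 ∈ ℝ^d. Set q = R²/(R² + λ) ∈ (0,1). Then the expected average loss of the final iterate satisfies E_τ L(w_k) ≤ e·‖w_0 − w⋆‖²·R² / (2·q·(2 − q)·k^{1 − q(1 − q/4)}). -/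
open Matrix

/-- Matrix-vector multiplication viewed as a map between Euclidean spaces. -/
noncomputable def mulVecE {n d : ℕ} (X : Matrix (Fin n) (Fin d) ℝ)
    (v : EuclideanSpace ℝ (Fin d)) : EuclideanSpace ℝ (Fin n) :=
  (WithLp.equiv 2 (Fin n → ℝ)).symm (X.mulVec (WithLp.equiv 2 (Fin d → ℝ) v))

open scoped BigOperators

section MulVecE

lemma mulVecE_add {n d : ℕ} (X : Matrix (Fin n) (Fin d) ℝ) (u v : EuclideanSpace ℝ (Fin d)) :
    mulVecE X (u + v) = mulVecE X u + mulVecE X v := by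
  ext i; simp [mulVecE, Matrix.mulVec_add]

lemma mulVecE_sub {n d : ℕ} (X : Matrix (Fin n) (Fin d) ℝ) (u v : EuclideanSpace ℝ (Fin d)) :
    mulVecE X (u - v) = mulVecE X u - mulVecE X v := by
  ext i; simp [mulVecE, Matrix.mulVec_sub]

lemma mulVecE_smul {n d : ℕ} (X : Matrix (Fin n) (Fin d) ℝ) (c : ℝ)
    (v : EuclideanSpace ℝ (Fin d)) :
    mulVecE X (c • v) = c • mulVecE X v := by
  ext i; simp [mulVecE, Matrix.mulVec_smul]

lemma mulVecE_mul {n d l : ℕ} (X : Matrix (Fin n) (Fin d) ℝ) (Y : Matrix (Fin d) (Fin l) ℝ)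
    (v : EuclideanSpace ℝ (Fin l)) :
    mulVecE (X * Y) v = mulVecE X (mulVecE Y v) := by
  ext i; simp [mulVecE, Matrix.mulVec_mulVec]

lemma mulVecE_reg {d : ℕ} (A : Matrix (Fin d) (Fin d) ℝ) (c : ℝ)
    (v : EuclideanSpace ℝ (Fin d)) :
    mulVecE (A + c • (1 : Matrix (Fin d) (Fin d) ℝ)) v = mulVecE A v + c • v := by
  ext i; simp [mulVecE, Matrix.add_mulVec, Matrix.smul_mulVec]

lemma mulVecE_one {d : ℕ} (v : EuclideanSpace ℝ (Fin d)) :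
    mulVecE (1 : Matrix (Fin d) (Fin d) ℝ) v = v := by
  ext i; simp [mulVecE]

lemma mulVecE_inner {n d : ℕ} (X : Matrix (Fin n) (Fin d) ℝ) (u : EuclideanSpace ℝ (Fin n))
    (v : EuclideanSpace ℝ (Fin d)) :
    inner ℝ (mulVecE Xᵀ u) v = inner ℝ u (mulVecE X v) := by
  simp only [mulVecE, EuclideanSpace.inner_eq_star_dotProduct]
  simp [Matrix.mulVec_transpose]
  rw [dotProduct_comm, ← Matrix.dotProduct_mulVec, dotProduct_comm]

lemma reg_isUnit {n d : ℕ} (X : Matrix (Fin n) (Fin d) ℝ) (lam : ℝ) (hlam : 0 < lam) :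
    IsUnit (Xᵀ * X + lam • (1 : Matrix (Fin d) (Fin d) ℝ)).det := by
  have h1 : (Xᵀ * X).PosSemidef := by
    simpa using Matrix.posSemidef_conjTranspose_mul_self X
  have h2 : (lam • (1 : Matrix (Fin d) (Fin d) ℝ)).PosDef := Matrix.PosDef.one.smul hlam
  have h3 := Matrix.PosDef.posSemidef_add h1 h2
  exact (Matrix.isUnit_iff_isUnit_det _).1 h3.isUnit

end MulVecE

section Abstract

variable {V : Type*} [NormedAddCommGroup V] [InnerProductSpace ℝ V]

/-- averaging operator -/
noncomputable def avgOp {M : ℕ} (B : Fin M → V → V) : (V → ℝ) →ₗ[ℝ] (V → ℝ) where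
  toFun g := fun e => (1 / (M : ℝ)) * ∑ m, g (B m e)
  map_add' g h := by
    funext e; simp [Finset.sum_add_distrib, mul_add]
  map_smul' c g := by
    funext e; simp only [Pi.smul_apply, smul_eq_mul, RingHom.id_apply, ← Finset.mul_sum]; ring

lemma avgOp_apply {M : ℕ} (B : Fin M → V → V) (g : V → ℝ) (e : V) :
    avgOp B g e = (1 / (M : ℝ)) * ∑ m, g (B m e) := rfl

lemma avgOp_mono {M : ℕ} (B : Fin M → V → V) {g h : V → ℝ} (hgh : ∀ e, g e ≤ h e) (e : V) :
    avgOp B g e ≤ avgOp B h e := by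
  rw [avgOp_apply, avgOp_apply]
  exact mul_le_mul_of_nonneg_left (Finset.sum_le_sum fun m _ => hgh _) (by positivity)

lemma avgOp_pow_mono {M : ℕ} (B : Fin M → V → V) (n : ℕ) :
    ∀ {g h : V → ℝ}, (∀ e, g e ≤ h e) → ∀ e, ((avgOp B) ^ n) g e ≤ ((avgOp B) ^ n) h e := by
  induction n with
  | zero => intro g h hgh e; simpa using hgh e
  | succ n ih =>
    intro g h hgh e
    rw [pow_succ, Module.End.mul_apply, Module.End.mul_apply]
    exact ih (avgOp_mono B hgh) e

lemma avgOp_const {M : ℕ} (hM : 0 < M) (B : Fin M → V → V) (c : ℝ) :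
    avgOp B (fun _ => c) = fun _ => c := by
  have : (M : ℝ) ≠ 0 := by positivity
  funext e; rw [avgOp_apply]; simp; field_simp

lemma avgOp_pow_const {M : ℕ} (hM : 0 < M) (B : Fin M → V → V) (c : ℝ) (n : ℕ) :
    ((avgOp B) ^ n) (fun _ => c) = fun _ => c := by
  induction n with
  | zero => simp
  | succ n ih => rw [pow_succ, Module.End.mul_apply, avgOp_const hM, ih]

lemma sum_traj {M : ℕ} (hM : 0 < M) (B : Fin M → V → V) (g : V → ℝ) (n : ℕ) :
    ∀ (x : V) (w : (Fin n → Fin M) → ℕ → V), (∀ τ, w τ 0 = x) →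
      (∀ τ (t : Fin n), w τ (t.1 + 1) = B (τ t) (w τ t.1)) →
      ∑ τ, g (w τ n) = (M : ℝ) ^ n * ((avgOp B) ^ n) g x := by
  have hM' : (M : ℝ) ≠ 0 := by positivity
  induction n with
  | zero => intro x w h0 _; simp [h0]
  | succ n ih =>
    intro x w h0 h1
    rw [← (Fin.consEquiv (fun _ : Fin (n + 1) => Fin M)).sum_comp, Fintype.sum_prod_type]
    have key : ∀ m : Fin M, ∑ σ : Fin n → Fin M,
        g (w ((Fin.consEquiv (fun _ : Fin (n + 1) => Fin M)) (m, σ)) (n + 1))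
        = (M : ℝ) ^ n * ((avgOp B) ^ n) g (B m x) := by
      intro m
      apply ih (B m x) (fun σ t => w ((Fin.consEquiv (fun _ : Fin (n + 1) => Fin M)) (m, σ)) (t + 1))
      · intro σ
        have := h1 (Fin.cons m σ) 0
        simpa [h0, Fin.consEquiv] using this
      · intro σ t
        have := h1 (Fin.cons m σ) t.succ
        simpa [Fin.consEquiv] using this
    rw [Finset.sum_congr rfl fun m _ => key m, ← Finset.mul_sum, pow_succ', pow_succ' (avgOp B),
      Module.End.mul_apply, avgOp_apply]
    field_simp

variable {M : ℕ} (hM : 0 < M) (B : Fin M → V → V) (F : V → ℝ) (α : ℝ)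

/-- multi-step descent from a one-step inequality -/
lemma multi_step (hM : 0 < M) (h : V → ℝ) (γ c : ℝ)
    (hstep : ∀ e, avgOp B h e ≤ h e - γ * F e + c) (n : ℕ) (e : V) :
    ((avgOp B) ^ n) h e + γ * ∑ t ∈ Finset.range n, ((avgOp B) ^ t) F e ≤ h e + n * c := by
  induction n with
  | zero => simp
  | succ n ih =>
    have h1 : ((avgOp B) ^ (n + 1)) h e
        ≤ ((avgOp B) ^ n) (h - γ • F + fun _ => c) e := by
      rw [pow_succ, Module.End.mul_apply]
      apply avgOp_pow_mono
      intro e; simpa using hstep e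
    rw [map_add, map_sub, map_smul, avgOp_pow_const hM] at h1
    simp only [Pi.add_apply, Pi.sub_apply, Pi.smul_apply, smul_eq_mul] at h1
    rw [Finset.sum_range_succ]
    push_cast
    linarith

end Abstract

lemma numeric_rate (γ : ℝ) (h0 : 0 < γ) (h1 : γ ≤ 1) (c : ℕ → ℝ) (hc : ∀ i, 0 ≤ c i) (k : ℕ)
    (hrec : ∀ j ≤ k, γ * ∑ i ∈ Finset.range (j + 1), c i ≤ (j + 1) * c j) :
    ∀ j ≤ k, ((j : ℝ) + 2) ^ γ * c 0 ≤ 2 ^ γ * ∑ i ∈ Finset.range (j + 1), c i := by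
  intro j
  induction j with
  | zero => intro _; simp
  | succ j ih =>
    intro hj
    have h2 := ih (by omega)
    have h3 := hrec (j + 1) hj
    rw [Finset.sum_range_succ] at h3 ⊢
    set S := ∑ i ∈ Finset.range (j + 1), c i with hS
    have hS0 : 0 ≤ S := Finset.sum_nonneg fun i _ => hc i
    push_cast at h3 ⊢
    have hj0 : (0 : ℝ) ≤ j := Nat.cast_nonneg j
    have hp : (0 : ℝ) < (j : ℝ) + 2 := by positivity
    have e1 : ((j : ℝ) + 1 + 2) ^ γ = ((j : ℝ) + 2) ^ γ * (1 + 1 / ((j : ℝ) + 2)) ^ γ := by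
      rw [← Real.mul_rpow (by positivity) (by positivity)]
      congr 1; field_simp; ring
    have e2 : (1 + 1 / ((j : ℝ) + 2)) ^ γ ≤ 1 + γ * (1 / ((j : ℝ) + 2)) :=
      rpow_one_add_le_one_add_mul_self (by
        have : 0 ≤ 1 / ((j : ℝ) + 2) := by positivity
        linarith) h0.le h1
    have e3 : (1 + γ * (1 / ((j : ℝ) + 2))) * S ≤ S + c (j + 1) := by
      have hcc := hc (j + 1)
      have : γ * (S + c (j + 1)) / ((j : ℝ) + 2) ≤ c (j + 1) := by
        rw [div_le_iff₀ hp]; linarith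
      have h5 : γ * (1 / ((j : ℝ) + 2)) * S ≤ γ * (S + c (j + 1)) / ((j : ℝ) + 2) := by
        rw [mul_one_div, div_mul_eq_mul_div]
        gcongr
        linarith
      linarith
    calc ((j : ℝ) + 1 + 2) ^ γ * c 0
        = (1 + 1 / ((j : ℝ) + 2)) ^ γ * (((j : ℝ) + 2) ^ γ * c 0) := by rw [e1]; ring
      _ ≤ (1 + γ * (1 / ((j : ℝ) + 2))) * (2 ^ γ * S) := by
          apply mul_le_mul e2 h2
          · exact mul_nonneg (by positivity) (hc 0)
          · positivity
      _ = 2 ^ γ * ((1 + γ * (1 / ((j : ℝ) + 2))) * S) := by ring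
      _ ≤ 2 ^ γ * (S + c (j + 1)) := by gcongr

lemma abstract_rate {V : Type*} [NormedAddCommGroup V] [InnerProductSpace ℝ V]
    {M : ℕ} (hM : 0 < M) (B : Fin M → V → V) (F : V → ℝ) (α : ℝ) (hα : 0 < α) (hα1 : α ≤ 1)
    (hF : ∀ e, 0 ≤ F e)
    (hstep : ∀ u e, avgOp B (fun x => ‖x - u‖ ^ 2) e ≤ ‖e - u‖ ^ 2 - α * F e + F u / α)
    (hstep0 : ∀ e, avgOp B (fun x => ‖x‖ ^ 2) e ≤ ‖e‖ ^ 2 - 2 * α * F e)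
    (k : ℕ) (hk : 1 ≤ k) (x : V) :
    ((avgOp B) ^ k) F x ≤ Real.exp 1 * ‖x‖ ^ 2 / (2 * α * (k : ℝ) ^ (α ^ 2)) := by
  have hnn : ∀ n e, 0 ≤ ((avgOp B) ^ n) F e := by
    intro n e
    have := avgOp_pow_mono B n (g := fun _ => 0) (h := F) hF e
    rwa [avgOp_pow_const hM] at this
  -- total
  have htot : 2 * α * ∑ t ∈ Finset.range (k + 1), ((avgOp B) ^ t) F x ≤ ‖x‖ ^ 2 := by
    have h1 := multi_step B F hM (fun x => ‖x‖ ^ 2) (2 * α) 0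
      (by intro e; have := hstep0 e; simpa using this) (k + 1) x
    have h2 := avgOp_pow_mono B (k + 1) (g := fun _ => 0) (h := fun x : V => ‖x‖ ^ 2)
      (fun e => by positivity) x
    rw [avgOp_pow_const hM] at h2
    simp only [mul_zero, add_zero] at h1
    linarith
  have hsuf : ∀ n u, α ^ 2 * ∑ t ∈ Finset.range n, ((avgOp B) ^ t) F u ≤ n * F u := by
    intro n u
    have h1 := multi_step B F hM (fun x => ‖x - u‖ ^ 2) α (F u / α) (hstep u) n u
    have h2 := avgOp_pow_mono B n (g := fun _ => 0) (h := fun x : V => ‖x - u‖ ^ 2)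
      (fun e => by positivity) u
    rw [avgOp_pow_const hM] at h2
    simp only [sub_self, norm_zero] at h1
    have h3 : α * ∑ t ∈ Finset.range n, ((avgOp B) ^ t) F u ≤ n * (F u / α) := by
      norm_num at h1; linarith
    calc α ^ 2 * ∑ t ∈ Finset.range n, ((avgOp B) ^ t) F u
        = α * (α * ∑ t ∈ Finset.range n, ((avgOp B) ^ t) F u) := by ring
      _ ≤ α * (n * (F u / α)) := by gcongr
      _ = n * F u := by field_simp
  have hrec : ∀ j ≤ k, α ^ 2 * ∑ i ∈ Finset.range (j + 1), ((avgOp B) ^ (k - i)) F x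
      ≤ (j + 1) * ((avgOp B) ^ (k - j)) F x := by
    intro j hj
    have h1 := avgOp_pow_mono B (k - j)
      (g := α ^ 2 • ∑ t ∈ Finset.range (j + 1), ((avgOp B) ^ t) F)
      (h := ((j + 1 : ℕ) : ℝ) • F)
      (fun e => by simpa [Finset.sum_apply] using hsuf (j + 1) e) x
    rw [map_smul, map_smul, map_sum] at h1
    simp only [Pi.smul_apply, smul_eq_mul, Finset.sum_apply] at h1
    have h2 : ∑ i ∈ Finset.range (j + 1), ((avgOp B) ^ (k - i)) F x
        = ∑ t ∈ Finset.range (j + 1), ((avgOp B) ^ (k - j)) (((avgOp B) ^ t) F) x := by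
      rw [← Finset.sum_range_reflect]
      apply Finset.sum_congr rfl
      intro i hi
      have := Finset.mem_range.1 hi
      have h3 : k - (j + 1 - 1 - i) = k - j + i := by omega
      rw [← Module.End.mul_apply, ← pow_add, h3]
    push_cast at h1
    rw [h2]
    exact h1
  have hrate := numeric_rate (α ^ 2) (by positivity) (by nlinarith)
    (fun i => ((avgOp B) ^ (k - i)) F x) (fun i => hnn _ _) k hrec k le_rfl
  have hrefl : ∑ i ∈ Finset.range (k + 1), ((avgOp B) ^ (k - i)) F x
      = ∑ t ∈ Finset.range (k + 1), ((avgOp B) ^ t) F x := by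
    rw [← Finset.sum_range_reflect (fun t => ((avgOp B) ^ t) F x)]
    apply Finset.sum_congr rfl
    intro i _
    congr 3
  simp only [Nat.sub_zero] at hrate
  rw [hrefl] at hrate
  have hk0 : (0 : ℝ) < k := by exact_mod_cast hk
  have hkp : (0 : ℝ) < (k : ℝ) ^ (α ^ 2) := Real.rpow_pos_of_pos hk0 _
  rw [le_div_iff₀ (by positivity)]
  have hmono : (k : ℝ) ^ (α ^ 2) ≤ ((k : ℝ) + 2) ^ (α ^ 2) :=
    Real.rpow_le_rpow hk0.le (by linarith) (by positivity)
  have h2 : (2 : ℝ) ^ (α ^ 2) ≤ Real.exp 1 := by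
    calc (2 : ℝ) ^ (α ^ 2) ≤ 2 ^ (1 : ℝ) :=
          Real.rpow_le_rpow_of_exponent_le (by norm_num) (by nlinarith)
      _ = 2 := Real.rpow_one 2
      _ ≤ Real.exp 1 := by have := Real.add_one_le_exp 1; linarith
  calc ((avgOp B) ^ k) F x * (2 * α * (k : ℝ) ^ (α ^ 2))
      = 2 * α * ((k : ℝ) ^ (α ^ 2) * ((avgOp B) ^ k) F x) := by ring
    _ ≤ 2 * α * (((k : ℝ) + 2) ^ (α ^ 2) * ((avgOp B) ^ k) F x) := by
        have := hnn k x
        gcongr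
    _ ≤ 2 * α * (2 ^ (α ^ 2) * ∑ t ∈ Finset.range (k + 1), ((avgOp B) ^ t) F x) := by gcongr
    _ = 2 ^ (α ^ 2) * (2 * α * ∑ t ∈ Finset.range (k + 1), ((avgOp B) ^ t) F x) := by ring
    _ ≤ Real.exp 1 * ‖x‖ ^ 2 := by
        apply mul_le_mul h2 htot _ (by positivity)
        have : 0 ≤ ∑ t ∈ Finset.range (k + 1), ((avgOp B) ^ t) F x :=
          Finset.sum_nonneg fun t _ => hnn t x
        positivity

/-- one regularized step, in error coordinates -/
noncomputable def stepB {n d : ℕ} (X : Matrix (Fin n) (Fin d) ℝ) (lam : ℝ)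
    (e : EuclideanSpace ℝ (Fin d)) : EuclideanSpace ℝ (Fin d) :=
  mulVecE (Xᵀ * X + lam • (1 : Matrix (Fin d) (Fin d) ℝ))⁻¹ (lam • e)

section Step

variable {n d : ℕ} (X : Matrix (Fin n) (Fin d) ℝ) (lam : ℝ) (hlam : 0 < lam)

lemma stepB_sub (e f : EuclideanSpace ℝ (Fin d)) :
    stepB X lam (e - f) = stepB X lam e - stepB X lam f := by
  simp [stepB, smul_sub, mulVecE_sub]

lemma stepB_smul (c : ℝ) (e : EuclideanSpace ℝ (Fin d)) :
    stepB X lam (c • e) = c • stepB X lam e := by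
  rw [stepB, stepB, smul_comm, mulVecE_smul]

include hlam in
lemma stepB_spec (e : EuclideanSpace ℝ (Fin d)) :
    mulVecE Xᵀ (mulVecE X (stepB X lam e)) = lam • (e - stepB X lam e) := by
  have h := mulVecE_reg (Xᵀ * X) lam (stepB X lam e)
  rw [stepB, ← mulVecE_mul, Matrix.mul_nonsing_inv _ (reg_isUnit X lam hlam), mulVecE_one,
    ← stepB, mulVecE_mul] at h
  rw [smul_sub, h]; abel

include hlam in
lemma stepB_inner (e f : EuclideanSpace ℝ (Fin d)) :
    lam * inner ℝ (e - stepB X lam e) f =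
      inner ℝ (mulVecE X (stepB X lam e)) (mulVecE X (stepB X lam f))
      + lam * inner ℝ (e - stepB X lam e) (f - stepB X lam f) := by
  have h : inner ℝ (mulVecE X (stepB X lam e)) (mulVecE X (stepB X lam f))
      = lam * inner ℝ (e - stepB X lam e) (stepB X lam f) := by
    rw [← mulVecE_inner, stepB_spec X lam hlam, real_inner_smul_left]
  rw [h, inner_sub_right]; ring

include hlam in
lemma stepB_symm (e f : EuclideanSpace ℝ (Fin d)) :
    inner ℝ (e - stepB X lam e) f = inner ℝ (f - stepB X lam f) e := by
  have h1 := stepB_inner X lam hlam e f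
  have h2 := stepB_inner X lam hlam f e
  rw [real_inner_comm (mulVecE X (stepB X lam e)), real_inner_comm (e - stepB X lam e)] at h2
  exact mul_left_cancel₀ hlam.ne' (h1.trans h2.symm)

include hlam in
lemma stepB_self (e : EuclideanSpace ℝ (Fin d)) :
    lam * inner ℝ (e - stepB X lam e) e =
      ‖mulVecE X (stepB X lam e)‖ ^ 2 + lam * ‖e - stepB X lam e‖ ^ 2 := by
  rw [stepB_inner X lam hlam e e, real_inner_self_eq_norm_sq, real_inner_self_eq_norm_sq]

include hlam in
lemma stepB_nonneg (e : EuclideanSpace ℝ (Fin d)) :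
    0 ≤ inner ℝ (e - stepB X lam e) e := by
  have h := stepB_self X lam hlam e
  have : 0 ≤ lam * inner ℝ (e - stepB X lam e) e := by rw [h]; positivity
  exact nonneg_of_mul_nonneg_right this hlam

variable (R : ℝ) (hR : 0 < R) (hX : ∀ v : EuclideanSpace ℝ (Fin d), ‖mulVecE X v‖ ≤ R * ‖v‖)

include hR hX in
lemma transpose_bound (u : EuclideanSpace ℝ (Fin n)) : ‖mulVecE Xᵀ u‖ ≤ R * ‖u‖ := by
  have h1 : ‖mulVecE Xᵀ u‖ ^ 2 ≤ (R * ‖u‖) * ‖mulVecE Xᵀ u‖ := by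
    rw [← real_inner_self_eq_norm_sq, mulVecE_inner]
    calc inner ℝ u (mulVecE X (mulVecE Xᵀ u)) ≤ ‖u‖ * ‖mulVecE X (mulVecE Xᵀ u)‖ :=
          real_inner_le_norm _ _
      _ ≤ ‖u‖ * (R * ‖mulVecE Xᵀ u‖) := by gcongr; exact hX _
      _ = _ := by ring
  by_contra hcon
  push Not at hcon
  have h0 : 0 ≤ R * ‖u‖ := by positivity
  nlinarith

include hlam hR hX in
lemma stepB_coco (e : EuclideanSpace ℝ (Fin d)) :
    ‖e - stepB X lam e‖ ^ 2 ≤ R ^ 2 / (R ^ 2 + lam) * inner ℝ (e - stepB X lam e) e := by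
  have h := stepB_self X lam hlam e
  have h1 := transpose_bound X R hR hX (mulVecE X (stepB X lam e))
  rw [stepB_spec X lam hlam, norm_smul, Real.norm_of_nonneg hlam.le] at h1
  set p := ‖e - stepB X lam e‖
  set a := ‖mulVecE X (stepB X lam e)‖
  set I := inner ℝ (e - stepB X lam e) e
  have h2 : (lam * p) ^ 2 ≤ (R * a) ^ 2 := by
    have : 0 ≤ p := norm_nonneg _
    gcongr
  rw [div_mul_eq_mul_div, le_div_iff₀ (by positivity)]
  refine le_of_mul_le_mul_left ?_ hlam
  nlinarith

include hlam hR hX in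
lemma stepB_loss (e : EuclideanSpace ℝ (Fin d)) :
    ‖mulVecE X e‖ ^ 2 ≤ (R ^ 2 + lam) * inner ℝ (e - stepB X lam e) e := by
  have h := stepB_self X lam hlam e
  have h1 : ‖mulVecE X e‖ ≤ ‖mulVecE X (stepB X lam e)‖ + R * ‖e - stepB X lam e‖ := by
    calc ‖mulVecE X e‖ = ‖mulVecE X (stepB X lam e) + mulVecE X (e - stepB X lam e)‖ := by
          rw [← mulVecE_add]; congr 2; abel
      _ ≤ _ := (norm_add_le _ _).trans (by gcongr; exact hX _)
  set p := ‖e - stepB X lam e‖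
  set a := ‖mulVecE X (stepB X lam e)‖
  set I := inner ℝ (e - stepB X lam e) e
  have h2 : ‖mulVecE X e‖ ^ 2 ≤ (a + R * p) ^ 2 := by gcongr
  refine h2.trans ?_
  refine le_of_mul_le_mul_left ?_ hlam
  have h3 : lam * ((R ^ 2 + lam) * I) = (R ^ 2 + lam) * (a ^ 2 + lam * p ^ 2) := by
    rw [← h]; ring
  rw [h3]
  nlinarith [sq_nonneg (R * a - lam * p)]

include hlam hR hX in
lemma stepB_descent (u e : EuclideanSpace ℝ (Fin d)) (α : ℝ) (hα : 0 < α)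
    (hq : R ^ 2 / (R ^ 2 + lam) = 2 - 2 * α) :
    ‖stepB X lam e - u‖ ^ 2 ≤ ‖e - u‖ ^ 2 - α * inner ℝ (e - stepB X lam e) e
      + inner ℝ (u - stepB X lam u) u / α := by
  have hc := stepB_coco X lam hlam R hR hX e
  rw [hq] at hc
  have hn := stepB_nonneg X lam hlam (α • e - u)
  have hs := stepB_symm X lam hlam e u
  have hexp : α • e - u - stepB X lam (α • e - u)
      = α • (e - stepB X lam e) - (u - stepB X lam u) := by
    rw [stepB_sub, stepB_smul, smul_sub]; abel
  rw [hexp] at hn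
  simp only [inner_sub_left (α • (e - stepB X lam e)), inner_sub_right _ (α • e) u,
    real_inner_smul_left, real_inner_smul_right] at hn
  have hd : ‖stepB X lam e - u‖ ^ 2 = ‖e - u‖ ^ 2
      - 2 * (inner ℝ (e - stepB X lam e) e - inner ℝ (e - stepB X lam e) u)
      + ‖e - stepB X lam e‖ ^ 2 := by
    rw [← inner_sub_right, real_inner_comm, ← norm_sub_sq_real]
    congr 2; abel
  rw [hd]
  have hy : 2 * inner ℝ (e - stepB X lam e) u ≤ α * inner ℝ (e - stepB X lam e) e
      + inner ℝ (u - stepB X lam u) u / α := by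
    refine le_of_mul_le_mul_left ?_ hα
    have : α * (α * inner ℝ (e - stepB X lam e) e + inner ℝ (u - stepB X lam u) u / α)
      = α ^ 2 * inner ℝ (e - stepB X lam e) e + inner ℝ (u - stepB X lam u) u := by
      field_simp
    rw [this]
    rw [← hs] at hn
    linarith
  linarith

include hlam hR hX in
lemma stepB_descent0 (e : EuclideanSpace ℝ (Fin d)) (α : ℝ)
    (hq : R ^ 2 / (R ^ 2 + lam) = 2 - 2 * α) :
    ‖stepB X lam e‖ ^ 2 ≤ ‖e‖ ^ 2 - 2 * α * inner ℝ (e - stepB X lam e) e := by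
  have hc := stepB_coco X lam hlam R hR hX e
  rw [hq] at hc
  have hd : ‖stepB X lam e‖ ^ 2 = ‖e‖ ^ 2
      - 2 * inner ℝ (e - stepB X lam e) e + ‖e - stepB X lam e‖ ^ 2 := by
    rw [real_inner_comm, ← norm_sub_sq_real]
    congr 2; abel
  linarith

include hlam in
lemma stepB_recur (y : EuclideanSpace ℝ (Fin n)) (ws v : EuclideanSpace ℝ (Fin d))
    (hy : mulVecE X ws = y) :
    mulVecE (Xᵀ * X + lam • (1 : Matrix (Fin d) (Fin d) ℝ))⁻¹ (mulVecE Xᵀ y + lam • v) - ws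
      = stepB X lam (v - ws) := by
  have h1 : mulVecE Xᵀ y + lam • v
      = mulVecE (Xᵀ * X + lam • (1 : Matrix (Fin d) (Fin d) ℝ)) ws + lam • (v - ws) := by
    rw [mulVecE_reg, mulVecE_mul, hy, smul_sub]; abel
  rw [h1, mulVecE_add, ← mulVecE_mul, Matrix.nonsing_inv_mul _ (reg_isUnit X lam hlam),
    mulVecE_one, stepB]
  abel

end Step

/-- for `M` jointly realizable tasks with data radius `R`, regularized
continual linear regression with fixed coefficient `λ` under a random with-replacement
ordering of length `k` satisfies, with `q = R²/(R²+λ)`,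
`E_τ L(w_k) ≤ e‖w₀−w⋆‖²R² / (2q(2−q) k^{1−q(1−q/4)})`. -/
theorem fixed_regularization_rate {d M : ℕ} (hM : 0 < M)
    (nrows : Fin M → ℕ)
    (X : ∀ m : Fin M, Matrix (Fin (nrows m)) (Fin d) ℝ)
    (y : ∀ m : Fin M, EuclideanSpace ℝ (Fin (nrows m)))
    (R : ℝ) (hR : 0 < R)
    (hX : ∀ (m : Fin M) (v : EuclideanSpace ℝ (Fin d)), ‖mulVecE (X m) v‖ ≤ R * ‖v‖)
    (wstar : EuclideanSpace ℝ (Fin d)) (hreal : ∀ m, mulVecE (X m) wstar = y m)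
    (lam : ℝ) (hlam : 0 < lam)
    (k : ℕ) (hk : 1 ≤ k)
    (w0 : EuclideanSpace ℝ (Fin d))
    (w : (Fin k → Fin M) → ℕ → EuclideanSpace ℝ (Fin d))
    (hw0 : ∀ τ, w τ 0 = w0)
    (hwt : ∀ (τ : Fin k → Fin M) (t : Fin k),
      w τ (t.1 + 1) =
        mulVecE ((X (τ t))ᵀ * X (τ t) + lam • (1 : Matrix (Fin d) (Fin d) ℝ))⁻¹
          (mulVecE (X (τ t))ᵀ (y (τ t)) + lam • w τ t.1)) :
    (∑ τ : Fin k → Fin M, (1 / (M : ℝ)) * ∑ m, (1 / 2) * ‖mulVecE (X m) (w τ k) - y m‖ ^ 2)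
        / (M : ℝ) ^ k
      ≤ Real.exp 1 * ‖w0 - wstar‖ ^ 2 * R ^ 2 /
          (2 * (R ^ 2 / (R ^ 2 + lam)) * (2 - R ^ 2 / (R ^ 2 + lam)) *
            (k : ℝ) ^ (1 - (R ^ 2 / (R ^ 2 + lam)) * (1 - (R ^ 2 / (R ^ 2 + lam)) / 4))) := by
  have hM' : (0 : ℝ) < M := by exact_mod_cast hM
  set q := R ^ 2 / (R ^ 2 + lam) with hq
  have hq0 : 0 < q := by positivity
  have hq1 : q < 1 := by rw [hq, div_lt_one (by positivity)]; linarith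
  set α := 1 - q / 2 with hα
  have hqα : R ^ 2 / (R ^ 2 + lam) = 2 - 2 * α := by rw [← hq, hα]; ring
  have hα0 : 0 < α := by rw [hα]; linarith
  set B : Fin M → EuclideanSpace ℝ (Fin d) → EuclideanSpace ℝ (Fin d) :=
    fun m => stepB (X m) lam with hB
  set F : EuclideanSpace ℝ (Fin d) → ℝ :=
    fun e => (1 / (M : ℝ)) * ∑ m, inner ℝ (e - stepB (X m) lam e) e with hF
  have hconst : ∀ c : ℝ, (1 / (M : ℝ)) * ∑ _m : Fin M, c = c := by
    intro c; simp; field_simp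
  have hrate := abstract_rate hM B F α hα0 (by rw [hα]; linarith)
    (by
      intro e
      exact mul_nonneg (by positivity)
        (Finset.sum_nonneg fun m _ => stepB_nonneg (X m) lam hlam e))
    (by
      intro u e
      rw [avgOp_apply]
      calc (1 / (M : ℝ)) * ∑ m, ‖B m e - u‖ ^ 2
          ≤ (1 / (M : ℝ)) * ∑ m, (‖e - u‖ ^ 2 - α * inner ℝ (e - stepB (X m) lam e) e
              + inner ℝ (u - stepB (X m) lam u) u / α) := by
            gcongr with m
            exact stepB_descent (X m) lam hlam R hR (hX m) u e α hα0 hqα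
        _ = _ := by
            rw [Finset.sum_add_distrib, Finset.sum_sub_distrib, ← Finset.mul_sum,
              ← Finset.sum_div, mul_add, mul_sub, hconst, hF]
            ring)
    (by
      intro e
      rw [avgOp_apply]
      calc (1 / (M : ℝ)) * ∑ m, ‖B m e‖ ^ 2
          ≤ (1 / (M : ℝ)) * ∑ m, (‖e‖ ^ 2 - 2 * α * inner ℝ (e - stepB (X m) lam e) e) := by
            gcongr with m
            exact stepB_descent0 (X m) lam hlam R hR (hX m) e α hqα
        _ = _ := by
            rw [Finset.sum_sub_distrib, ← Finset.mul_sum, mul_sub, hconst, hF]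
            ring)
    k hk (w0 - wstar)
  have htraj := sum_traj hM B F k (w0 - wstar) (fun τ t => w τ t - wstar)
    (by intro τ; simp [hw0])
    (by
      intro τ t
      simp only [hB]
      rw [hwt, stepB_recur (X (τ t)) lam hlam _ wstar _ (hreal _)])
  have hexp : 1 - q * (1 - q / 4) = α ^ 2 := by rw [hα]; ring
  have hloss : ∀ τ : Fin k → Fin M,
      (1 / (M : ℝ)) * ∑ m, (1 / 2) * ‖mulVecE (X m) (w τ k) - y m‖ ^ 2
        ≤ (R ^ 2 + lam) / 2 * F (w τ k - wstar) := by
    intro τ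
    have : (R ^ 2 + lam) / 2 * F (w τ k - wstar) = (1 / (M : ℝ)) * ∑ m, (1 / 2) *
        ((R ^ 2 + lam) * inner ℝ (w τ k - wstar - stepB (X m) lam (w τ k - wstar))
          (w τ k - wstar)) := by
      rw [hF, ← Finset.mul_sum, ← Finset.mul_sum]; ring
    rw [this]
    gcongr with m
    rw [← hreal m, ← mulVecE_sub]
    exact stepB_loss (X m) lam hlam R hR (hX m) _
  rw [hexp]
  have hk0 : (0 : ℝ) < k := by exact_mod_cast hk
  have hkp : (0 : ℝ) < (k : ℝ) ^ (α ^ 2) := Real.rpow_pos_of_pos hk0 _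
  have h2q : 2 - q = 2 * α := by rw [hα]; ring
  have hRq : R ^ 2 + lam = R ^ 2 / q := by rw [hq]; field_simp
  calc (∑ τ : Fin k → Fin M,
          (1 / (M : ℝ)) * ∑ m, (1 / 2) * ‖mulVecE (X m) (w τ k) - y m‖ ^ 2) / (M : ℝ) ^ k
      ≤ (∑ τ : Fin k → Fin M, (R ^ 2 + lam) / 2 * F (w τ k - wstar)) / (M : ℝ) ^ k := by
        exact div_le_div_of_nonneg_right (Finset.sum_le_sum fun τ _ => hloss τ) (by positivity)
    _ = (R ^ 2 + lam) / 2 * ((avgOp B) ^ k) F (w0 - wstar) := by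
        rw [← Finset.mul_sum, htraj]; field_simp
    _ ≤ (R ^ 2 + lam) / 2 * (Real.exp 1 * ‖w0 - wstar‖ ^ 2 / (2 * α * (k : ℝ) ^ (α ^ 2))) := by
        gcongr
    _ = _ := by
        rw [h2q, hRq]; field_simp
end

section
/- Let M ≥ 1, β > 0, and let f(·; m) : ℝ^d → ℝ for m = 1,…,M be convex and β-smooth, with average F(w) = (1/M)Σ_{m=1}^M f(w; m). Let k ≥ 2, and let surrogates \tilde f^{(t)}(·; m) : ℝ^d → ℝ for t = 1,…,k, m = 1,…,M be convex and β-smooth. Assume joint realizability: there exists w⋆ ∈ ℝ^d such that f(w⋆; m) = 0 = min_w f(w; m) and \tilde f^{(t)}(w⋆; m) = 0 = min_w \tilde f^{(t)}(w; m) for all t, m. Assume there exist ν_t ≥ 0 such that for all t, m, w: \tilde f^{(t)}(w; m) − \tilde f^{(t)}(w⋆; m) ≤ f(w; m) − f(w⋆; m) ≤ (1 + ν_t β)(\tilde f^{(t)}(w; m) − \tilde f^{(t)}(w⋆; m)). Let 0 < η ≤ 3/(13β), set η_t = η·(k−t+2)/(k+1), and assume ν_t ≤ η_t for all t. Let τ_1,…,τ_k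 be i.i.d. uniform on {1,…,M}, fix w_0 ∈ ℝ^d, and set w_t = w_{t−1} − η_t ∇\tilde f^{(t)}(w_{t−1}; τ_t) for t = 1,…,k. Then E F(w_k) − F(w⋆) ≤ 9‖w_0 − w⋆‖²/(2η(k+1)); in particular, with η = 3/(13β), E F(w_k) − F(w⋆) ≤ 20β‖w_0 − w⋆‖²/(k+1). -/
open Finset in
/-- Resampling one coordinate of a uniformly random tuple. -/
lemma sgdaux_resample {k M : ℕ} (t : Fin k) (g : (Fin k → Fin M) → ℝ) :
    ∑ τ, ∑ m, g (Function.update τ t m) = (M : ℝ) * ∑ τ, g τ := by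
  classical
  have h : ∑ p : (Fin k → Fin M) × Fin M, g (Function.update p.1 t p.2)
      = ∑ p : (Fin k → Fin M) × Fin M, g p.1 := by
    let φ : (Fin k → Fin M) × Fin M → (Fin k → Fin M) × Fin M :=
      fun p => (Function.update p.1 t p.2, p.1 t)
    have hφ : Function.Involutive φ := by
      intro p
      simp [φ]
    exact Equiv.sum_comp (hφ.toPerm φ) (fun p => g p.1)
  rw [Fintype.sum_prod_type, Fintype.sum_prod_type] at h
  rw [h]
  simp [Finset.mul_sum]

section SgdAux
variable {E : Type*} [NormedAddCommGroup E] [InnerProductSpace ℝ E] [CompleteSpace E]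

lemma sgdaux_line {h : E → ℝ} (hd : Differentiable ℝ h) (x v : E) (s : ℝ) :
    HasDerivAt (fun s : ℝ => h (x + s • v)) (inner ℝ (gradient h (x + s • v)) v) s := by
  have h1 : HasDerivAt (fun s : ℝ => x + s • v) v s := by
    simpa using ((hasDerivAt_id s).smul_const v).const_add x
  have h2 := (hd (x + s • v)).hasGradientAt.hasFDerivAt
  have h3 := h2.comp_hasDerivAt s h1
  refine HasDerivAt.congr_deriv (f := fun s : ℝ => h (x + s • v)) h3 ?_
  simp

lemma sgdaux_convex {h : E → ℝ} (hd : Differentiable ℝ h) (hc : ConvexOn ℝ Set.univ h)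
    (x z : E) : h x + inner ℝ (gradient h x) (z - x) ≤ h z := by
  have h1 := sgdaux_line hd x (z - x) 0
  have h2 : ConvexOn ℝ Set.univ (fun s : ℝ => h (x + s • (z - x))) := by
    refine ⟨convex_univ, ?_⟩
    intro a _ b _ p q hp hq hpq
    have := hc.2 (Set.mem_univ (x + a • (z - x))) (Set.mem_univ (x + b • (z - x))) hp hq hpq
    convert this using 2
    have : p • x + q • x = x := by rw [← add_smul, hpq, one_smul]
    simp only [smul_add, smul_smul, add_smul, smul_eq_mul]
    nth_rewrite 1 [← this]
    abel
  have h3 := h2.le_slope_of_hasDerivAt (Set.mem_univ 0) (Set.mem_univ 1) one_pos h1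
  rw [slope_def_field, zero_smul, add_zero] at h3
  simp only [zero_smul, add_zero, one_smul, sub_zero, div_one, add_sub_cancel] at h3
  linarith

lemma sgdaux_descent {h : E → ℝ} (hd : Differentiable ℝ h) {β : ℝ}
    (hs : ∀ u v, ‖gradient h u - gradient h v‖ ≤ β * ‖u - v‖) (x v : E) :
    h (x + v) ≤ h x + inner ℝ (gradient h x) v + β / 2 * ‖v‖ ^ 2 := by
  let φ : ℝ → ℝ := fun s => h (x + s • v) - (s * inner ℝ (gradient h x) v + β / 2 * ‖v‖ ^ 2 * s ^ 2)
  have hφ : ∀ s, HasDerivAt φ (inner ℝ (gradient h (x + s • v)) v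
      - (inner ℝ (gradient h x) v + β / 2 * ‖v‖ ^ 2 * (2 * s))) s := by
    intro s
    have h1 := sgdaux_line hd x v s
    have h2 : HasDerivAt (fun s : ℝ => s * inner ℝ (gradient h x) v + β / 2 * ‖v‖ ^ 2 * s ^ 2)
        (inner ℝ (gradient h x) v + β / 2 * ‖v‖ ^ 2 * (2 * s)) s := by
      have h3 := ((hasDerivAt_id s).mul_const (inner ℝ (gradient h x) v)).add
        (((hasDerivAt_id s).pow 2).const_mul (β / 2 * ‖v‖ ^ 2))
      refine HasDerivAt.congr_deriv
        (f := fun s : ℝ => s * inner ℝ (gradient h x) v + β / 2 * ‖v‖ ^ 2 * s ^ 2) h3 ?_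
      simp only [id, one_mul, mul_one, Nat.cast_ofNat, Nat.add_one_sub_one, pow_one]
    exact h1.sub h2
  have hanti : AntitoneOn φ (Set.Ici 0) := by
    apply antitoneOn_of_deriv_nonpos (convex_Ici 0)
    · exact fun s _ => (hφ s).continuousAt.continuousWithinAt
    · exact fun s _ => (hφ s).differentiableAt.differentiableWithinAt
    · intro s hsm
      rw [interior_Ici] at hsm
      have hs0 : 0 < s := hsm
      rw [(hφ s).deriv]
      have h1 : inner ℝ (gradient h (x + s • v) - gradient h x) v ≤ β * (s * ‖v‖) * ‖v‖ := by
        refine (real_inner_le_norm _ _).trans ?_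
        have := hs (x + s • v) x
        rw [add_sub_cancel_left, norm_smul, Real.norm_of_nonneg hs0.le] at this
        gcongr
      rw [inner_sub_left] at h1
      nlinarith
  have := hanti (Set.mem_Ici.2 le_rfl) (Set.mem_Ici.2 zero_le_one) zero_le_one
  simp only [φ, zero_smul, add_zero, one_smul, zero_mul, one_mul, one_pow, mul_one, ne_eq,
    OfNat.ofNat_ne_zero, not_false_eq_true, zero_pow, mul_zero, sub_zero] at this
  linarith

lemma sgdaux_grad {h : E → ℝ} (hd : Differentiable ℝ h) {β : ℝ} (hβ : 0 < β)
    (hs : ∀ u v, ‖gradient h u - gradient h v‖ ≤ β * ‖u - v‖) (h0 : ∀ u, 0 ≤ h u) (x : E) :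
    ‖gradient h x‖ ^ 2 ≤ 2 * β * h x := by
  have h1 := sgdaux_descent hd hs x (-(β⁻¹ • gradient h x))
  have h2 := h0 (x + -(β⁻¹ • gradient h x))
  rw [inner_neg_right, inner_smul_right, norm_neg, norm_smul, real_inner_self_eq_norm_sq,
    Real.norm_of_nonneg (inv_nonneg.2 hβ.le)] at h1
  have h3 : 0 ≤ h x - β⁻¹ / 2 * ‖gradient h x‖ ^ 2 := by
    have : β / 2 * (β⁻¹ * ‖gradient h x‖) ^ 2 = β⁻¹ / 2 * ‖gradient h x‖ ^ 2 := by
      field_simp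
    linarith
  have h4 : β⁻¹ / 2 * ‖gradient h x‖ ^ 2 * (2 * β) = ‖gradient h x‖ ^ 2 := by
    field_simp
  nlinarith

/-- One gradient step. -/
lemma sgdaux_step {h : E → ℝ} (hd : Differentiable ℝ h) (hc : ConvexOn ℝ Set.univ h)
    {β : ℝ} (hβ : 0 < β)
    (hs : ∀ u v, ‖gradient h u - gradient h v‖ ≤ β * ‖u - v‖) (h0 : ∀ u, 0 ≤ h u)
    (e : ℝ) (he : 0 ≤ e) (x z : E) :
    ‖x - e • gradient h x - z‖ ^ 2
      ≤ ‖x - z‖ ^ 2 - 2 * e * ((1 - β * e) * h x - h z) := by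
  have h1 := sgdaux_convex hd hc x z
  have h2 := sgdaux_grad hd hβ hs h0 x
  have h3 : x - e • gradient h x - z = (x - z) - e • gradient h x := by abel
  rw [h3, norm_sub_sq_real, inner_smul_right, norm_smul, Real.norm_of_nonneg he, real_inner_comm]
  have h4 : inner ℝ (gradient h x) (z - x) = - inner ℝ (gradient h x) (x - z) := by
    rw [← inner_neg_right, neg_sub]
  rw [h4] at h1
  have h5 := mul_le_mul_of_nonneg_left h1 he
  have h6 := mul_le_mul_of_nonneg_left h2 (mul_nonneg he he)
  nlinarith

/-- The comparison points: running weighted averages of `ws` and the iterates. -/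
noncomputable def sgdauxZ (u : ℕ → ℝ) (ws : E) (w : ℕ → E) : ℕ → E
  | 0 => ws
  | t + 1 => (u t / u (t + 1)) • sgdauxZ u ws w t + ((u (t + 1) - u t) / u (t + 1)) • w t

lemma sgdauxZ_congr (u : ℕ → ℝ) (ws : E) (w w' : ℕ → E) (t : ℕ)
    (h : ∀ s, s < t → w s = w' s) : sgdauxZ u ws w t = sgdauxZ u ws w' t := by
  induction t with
  | zero => rfl
  | succ n ih =>
    simp only [sgdauxZ]
    rw [ih (fun s hs => h s (by omega)), h n (by omega)]

lemma sgdauxZ_sub (u : ℕ → ℝ) (ws : E) (w : ℕ → E) (t : ℕ) (hu : 0 < u (t + 1)) (hu0 : 0 ≤ u t) :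
    u (t + 1) ^ 2 * ‖w t - sgdauxZ u ws w (t + 1)‖ ^ 2
      = u t ^ 2 * ‖w t - sgdauxZ u ws w t‖ ^ 2 := by
  have h1 : w t - sgdauxZ u ws w (t + 1) = (u t / u (t + 1)) • (w t - sgdauxZ u ws w t) := by
    have h2 : (u (t + 1) - u t) / u (t + 1) = 1 - u t / u (t + 1) := by field_simp
    simp only [sgdauxZ]
    rw [h2, sub_smul, one_smul, smul_sub]
    abel
  rw [h1, norm_smul, Real.norm_of_nonneg (by positivity)]
  field_simp

lemma sgdauxZ_convex {h : E → ℝ} (hc : ConvexOn ℝ Set.univ h)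
    (u : ℕ → ℝ) (ws : E) (w : ℕ → E) (t : ℕ) (hu : 0 < u (t + 1)) (hu0 : 0 ≤ u t)
    (hle : u t ≤ u (t + 1)) :
    u (t + 1) * h (sgdauxZ u ws w (t + 1))
      ≤ u t * h (sgdauxZ u ws w t) + (u (t + 1) - u t) * h (w t) := by
  have h1 := hc.2 (Set.mem_univ (sgdauxZ u ws w t)) (Set.mem_univ (w t))
    (show 0 ≤ u t / u (t + 1) by positivity)
    (show 0 ≤ (u (t + 1) - u t) / u (t + 1) from div_nonneg (by linarith) hu.le)
    (by field_simp; ring)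
  have h2 := mul_le_mul_of_nonneg_left h1 hu.le
  simp only [sgdauxZ]
  refine h2.trans (le_of_eq ?_)
  simp only [smul_eq_mul]
  field_simp

end SgdAux

lemma sgdaux_coef (β η T n : ℝ) (hβ : 0 < β) (hη : 0 < η) (hβη : β * η ≤ 3 / 13)
    (hn : 1 ≤ n) (hnT : n ≤ T) :
    η * (n + n * (n + 1) / (4 * T)) * ((T / n + 1 / 2) - (T / (n + 1) + 1 / 2))
      ≤ (T / n + 1 / 2) ^ 2 * (η * (n / T))
        * ((1 - β * (η * (n / T))) / (1 + β * (η * (n / T)))) := by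
  have hn0 : 0 < n := by linarith
  have hT0 : 0 < T := by linarith
  have hL : η * (n + n * (n + 1) / (4 * T)) * ((T / n + 1 / 2) - (T / (n + 1) + 1 / 2))
      = η * (T / (n + 1)) + η / 4 := by
    field_simp
    ring
  have hle : T / (n + 1) ≤ T / n := by gcongr; linarith
  obtain ⟨x, hx⟩ : ∃ x, x = n / T := ⟨_, rfl⟩
  have hx0 : 0 < x := by rw [hx]; positivity
  have hx1 : x ≤ 1 := by rw [hx, div_le_one hT0]; exact hnT
  have hTn : T / n = 1 / x := by rw [hx]; field_simp
  rw [hL, ← hx, hTn]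
  rw [hTn] at hle
  obtain ⟨y, hy⟩ : ∃ y, y = β * η := ⟨_, rfl⟩
  have hy0 : 0 < y := by rw [hy]; positivity
  rw [← mul_assoc β η x, ← hy]
  rw [← hy] at hβη
  have key : (1 + x / 4) ≤ (1 + x / 2) ^ 2 * ((1 - y * x) / (1 + y * x)) := by
    rw [← mul_div_assoc, le_div_iff₀ (by positivity)]
    have h1 : y * x ≤ 3 / 13 * x := by gcongr
    have h2 : (1 + x / 4) * (1 + 3 / 13 * x) ≤ (1 + x / 2) ^ 2 * (1 - 3 / 13 * x) := by
      have : 0 ≤ x * (15 - 2 * x - 3 * x ^ 2) := by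
        apply mul_nonneg hx0.le
        nlinarith
      nlinarith
    have h3 : (1 + x / 4) * (1 + y * x) ≤ (1 + x / 4) * (1 + 3 / 13 * x) := by gcongr
    have h4 : (1 + x / 2) ^ 2 * (1 - 3 / 13 * x) ≤ (1 + x / 2) ^ 2 * (1 - y * x) := by gcongr
    linarith
  have e1 : (1 / x + 1 / 2) ^ 2 * (η * x) * ((1 - y * x) / (1 + y * x))
      = η / x * ((1 + x / 2) ^ 2 * ((1 - y * x) / (1 + y * x))) := by
    field_simp
    try ring
  rw [e1]
  calc η * (T / (n + 1)) + η / 4 ≤ η * (1 / x) + η / 4 := by gcongr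
    _ = η / x * (1 + x / 4) := by field_simp
    _ ≤ _ := by gcongr

lemma sgdaux_recursion (k : ℕ) (hk : 2 ≤ k) (β η T : ℝ) (hT : T = k + 1) (hβ : 0 < β) (hη : 0 < η)
    (hβη : β * η ≤ 3 / 13) (u e c R B a : ℕ → ℝ) (D : ℝ)
    (hu : ∀ t : ℕ, u t = T / (T + 1 - t) + 1 / 2)
    (he : ∀ t : ℕ, e t = η * ((T - t) / T))
    (hc : ∀ t, c t = (1 - β * e t) / (1 + β * e t))
    (ha : ∀ t, 0 ≤ a t) (hB0 : B 0 = 0)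
    (hD : 0 ≤ D) (hR0 : R 0 = u 0 ^ 2 * D)
    (hB : ∀ t, t ≤ k → B (t + 1) ≤ B t + (u (t + 1) - u t) * a t)
    (hR : ∀ t, t < k → R (t + 1) ≤ R t - 2 * u (t + 1) * e t * (u (t + 1) * c t * a t - B (t + 1)))
    (hlast : 0 ≤ R k - 2 * u (k + 1) * e k * (u (k + 1) * c k * a k - B (k + 1))) :
    a k ≤ 9 / 2 * D / (η * T) := by
  have hk' : (2 : ℝ) ≤ k := by exact_mod_cast hk
  have hT0 : 0 < T := by linarith
  let S : ℕ → ℝ := fun t => η * ((T - t) + (T - t) * ((T - t) + 1) / (4 * T))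
  have hun : ∀ t : ℕ, u (t + 1) = T / (T - t) + 1 / 2 := by
    intro t; rw [hu]; push_cast; congr 2; ring
  have hun' : ∀ t : ℕ, u t = T / ((T - t) + 1) + 1 / 2 := by
    intro t; rw [hu]; congr 2; ring
  have hn1 : ∀ t : ℕ, t ≤ k → (1 : ℝ) ≤ T - t := by
    intro t ht
    have : (t : ℝ) ≤ k := by exact_mod_cast ht
    linarith
  have hSnn : ∀ t : ℕ, t ≤ k → 0 ≤ S t := by
    intro t ht
    have := hn1 t ht
    have : 0 ≤ T - t := by linarith
    positivity
  have hS : ∀ t : ℕ, t ≤ k → S t = S (t + 1) + u (t + 1) * e t := by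
    intro t ht
    have := hn1 t ht
    have : T - t ≠ 0 := by intro h; linarith
    simp only [S]
    rw [hun, he]
    push_cast
    field_simp
    ring
  have hcoef : ∀ t : ℕ, t ≤ k → S t * (u (t + 1) - u t) ≤ u (t + 1) ^ 2 * e t * c t := by
    intro t ht
    rw [hc, he, hun, hun']
    exact sgdaux_coef β η T (T - t) hβ hη hβη (hn1 t ht) (by
      have : (0 : ℝ) ≤ t := by positivity
      linarith)
  have hV : ∀ t : ℕ, t ≤ k → R t + 2 * S t * B t ≤ u 0 ^ 2 * D := by
    intro t
    induction t with
    | zero => intro _; rw [hB0, hR0]; simp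
    | succ t ih =>
      intro ht
      have i1 := ih (by omega)
      have i2 := hR t (by omega)
      have i3 := mul_le_mul_of_nonneg_left (hB t (by omega)) (hSnn t (by omega))
      have i4 := mul_le_mul_of_nonneg_right (hcoef t (by omega)) (ha t)
      have i5 := hS t (by omega)
      have i6 : S t * B (t + 1) = (S (t + 1) + u (t + 1) * e t) * B (t + 1) := by rw [← i5]
      nlinarith
  have hVk := hV k le_rfl
  have j3 := mul_le_mul_of_nonneg_left (hB k le_rfl) (hSnn k le_rfl)
  have hSk : S k = u (k + 1) * e k := by
    rw [hS k le_rfl]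
    have : S (k + 1) = 0 := by simp [S, hT]
    rw [this, zero_add]
  have j4 : 2 * (u (k + 1) ^ 2 * e k * c k - S k * (u (k + 1) - u k)) * a k ≤ u 0 ^ 2 * D := by
    have : S k * B (k + 1) = u (k + 1) * e k * B (k + 1) := by rw [hSk]
    nlinarith
  have hu0 : u 0 ^ 2 ≤ 9 / 4 := by
    have h1 : T / (T + 1) ≤ 1 := by rw [div_le_one (by linarith)]; linarith
    have h2 : 0 ≤ T / (T + 1) := by positivity
    rw [hu]
    simp only [Nat.cast_zero, sub_zero]
    nlinarith
  have hTk : T - k = 1 := by linarith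
  have hek : e k = η / T := by rw [he, hTk]; ring
  have huk : u (k + 1) = T + 1 / 2 := by rw [hun, hTk]; ring
  have huk' : u k = T / 2 + 1 / 2 := by rw [hun', hTk]; norm_num
  have hck : 3 / 4 ≤ c k := by
    have h1 : β * e k ≤ 1 / 13 := by
      rw [hek, ← mul_div_assoc, div_le_iff₀ hT0]
      linarith
    have h2 : 0 < β * e k := by rw [hek]; positivity
    rw [hc, le_div_iff₀ (by linarith)]
    linarith
  have j5 : η * T / 4 ≤ u (k + 1) ^ 2 * e k * c k - S k * (u (k + 1) - u k) := by
    rw [hSk, huk, huk', hek]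
    have : (T + 1 / 2) ^ 2 * (η / T) * c k - (T + 1 / 2) * (η / T) * (T + 1 / 2 - (T / 2 + 1 / 2))
        = (η / T) * ((T + 1 / 2) * ((T + 1 / 2) * c k - T / 2)) := by ring
    rw [this]
    have h2 : T / 4 ≤ (T + 1 / 2) * c k - T / 2 := by nlinarith
    have h3 : T * (T / 4) ≤ (T + 1 / 2) * ((T + 1 / 2) * c k - T / 2) := by
      apply mul_le_mul _ h2 <;> linarith
    calc η * T / 4 = η / T * (T * (T / 4)) := by field_simp
      _ ≤ _ := by gcongr
  rw [le_div_iff₀ (by positivity)]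
  have j6 := mul_le_mul_of_nonneg_right j5 (ha k)
  have j7 := mul_le_mul_of_nonneg_right hu0 hD
  nlinarith

lemma sgdaux_indep {k M : ℕ} (hM : 1 ≤ M) {E : Type*} (t : Fin k) (Y : (Fin k → Fin M) → E)
    (hY : ∀ τ m, Y (Function.update τ t m) = Y τ) (g : Fin M → E → ℝ) :
    ∑ τ, g (τ t) (Y τ) = ∑ τ, (1 / (M : ℝ)) * ∑ m, g m (Y τ) := by
  have h := sgdaux_resample t (fun τ : Fin k → Fin M => g (τ t) (Y τ))
  simp only [hY, Function.update_self] at h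
  have hM0 : (M : ℝ) ≠ 0 := by
    have : M ≠ 0 := by omega
    exact_mod_cast this
  rw [← Finset.mul_sum, h]
  field_simp

/-- last-iterate guarantee for SGD on time-varying surrogate losses
with the linearly decaying step sizes `η_t = η(k−t+2)/(k+1)` (below `t` is 0-indexed,
so step `t` uses `η·((k−t)+1)/(k+1)`):
`E F(w_k) − F(w⋆) ≤ 9‖w₀−w⋆‖²/(2η(k+1))`, and with `η = 3/(13β)` this gives
`E F(w_k) − F(w⋆) ≤ 20β‖w₀−w⋆‖²/(k+1)`. -/
theorem sgd_time_varying_expected_loss {d M : ℕ} (hM : 1 ≤ M)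
    (β : ℝ) (hβ : 0 < β)
    (f : Fin M → EuclideanSpace ℝ (Fin d) → ℝ)
    (hfdiff : ∀ m, Differentiable ℝ (f m))
    (hfconv : ∀ m, ConvexOn ℝ Set.univ (f m))
    (hfsmooth : ∀ (m : Fin M) (u v : EuclideanSpace ℝ (Fin d)),
      ‖gradient (f m) u - gradient (f m) v‖ ≤ β * ‖u - v‖)
    (k : ℕ) (hk : 2 ≤ k)
    (tf : Fin k → Fin M → EuclideanSpace ℝ (Fin d) → ℝ)
    (htfdiff : ∀ t m, Differentiable ℝ (tf t m))
    (htfconv : ∀ t m, ConvexOn ℝ Set.univ (tf t m))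
    (htfsmooth : ∀ (t : Fin k) (m : Fin M) (u v : EuclideanSpace ℝ (Fin d)),
      ‖gradient (tf t m) u - gradient (tf t m) v‖ ≤ β * ‖u - v‖)
    (wstar : EuclideanSpace ℝ (Fin d))
    (hfreal : ∀ m, f m wstar = 0 ∧ ∀ w, f m wstar ≤ f m w)
    (htfreal : ∀ t m, tf t m wstar = 0 ∧ ∀ w, tf t m wstar ≤ tf t m w)
    (ν : Fin k → ℝ) (hν : ∀ t, 0 ≤ ν t)
    (hsand : ∀ (t : Fin k) (m : Fin M) (w : EuclideanSpace ℝ (Fin d)),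
      tf t m w - tf t m wstar ≤ f m w - f m wstar ∧
      f m w - f m wstar ≤ (1 + ν t * β) * (tf t m w - tf t m wstar))
    (η : ℝ) (hηpos : 0 < η) (hηle : η ≤ 3 / (13 * β))
    (ηt : Fin k → ℝ)
    (hηt : ∀ t : Fin k, ηt t = η * (((k : ℝ) - (t.1 : ℝ) + 1) / ((k : ℝ) + 1)))
    (hνη : ∀ t, ν t ≤ ηt t)
    (w0 : EuclideanSpace ℝ (Fin d))
    (w : (Fin k → Fin M) → ℕ → EuclideanSpace ℝ (Fin d))
    (hw0 : ∀ τ, w τ 0 = w0)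
    (hwt : ∀ (τ : Fin k → Fin M) (t : Fin k),
      w τ (t.1 + 1) = w τ t.1 - ηt t • gradient (tf t (τ t)) (w τ t.1)) :
    (∑ τ : Fin k → Fin M,
        ((1 / (M : ℝ)) * ∑ m, f m (w τ k) - (1 / (M : ℝ)) * ∑ m, f m wstar))
        / (M : ℝ) ^ k
      ≤ 9 * ‖w0 - wstar‖ ^ 2 / (2 * η * ((k : ℝ) + 1)) ∧
    (η = 3 / (13 * β) →
      (∑ τ : Fin k → Fin M,
          ((1 / (M : ℝ)) * ∑ m, f m (w τ k) - (1 / (M : ℝ)) * ∑ m, f m wstar))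
          / (M : ℝ) ^ k
        ≤ 20 * β * ‖w0 - wstar‖ ^ 2 / ((k : ℝ) + 1)) := by
  classical
  have hM0 : (0 : ℝ) < M := by exact_mod_cast hM
  have hβη : β * η ≤ 3 / 13 := by
    rw [le_div_iff₀ (by positivity)] at hηle
    linarith
  obtain ⟨T, hT⟩ : ∃ T : ℝ, T = (k : ℝ) + 1 := ⟨_, rfl⟩
  have hk' : (2 : ℝ) ≤ k := by exact_mod_cast hk
  have hT0 : 0 < T := by linarith
  obtain ⟨u, hu⟩ : ∃ u : ℕ → ℝ, ∀ t : ℕ, u t = T / (T + 1 - t) + 1 / 2 := ⟨_, fun _ => rfl⟩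
  obtain ⟨e, he⟩ : ∃ e : ℕ → ℝ, ∀ t : ℕ, e t = η * ((T - t) / T) := ⟨_, fun _ => rfl⟩
  obtain ⟨c, hc⟩ : ∃ c : ℕ → ℝ, ∀ t : ℕ, c t = (1 - β * e t) / (1 + β * e t) :=
    ⟨_, fun _ => rfl⟩
  have hηe : ∀ t : Fin k, ηt t = e t.1 := by
    intro t
    rw [hηt, he, hT]
    congr 2
    ring
  have hlt : ∀ t : ℕ, t ≤ k → (t : ℝ) + 1 ≤ T := by
    intro t ht
    have : (t : ℝ) ≤ k := by exact_mod_cast ht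
    linarith
  have hupos : ∀ t : ℕ, t ≤ k + 1 → 0 < u t := by
    intro t ht
    have h1 : (t : ℝ) ≤ k + 1 := by exact_mod_cast ht
    have h2 : 0 < T + 1 - t := by linarith
    rw [hu]
    positivity
  have humono : ∀ t : ℕ, t ≤ k → u t ≤ u (t + 1) := by
    intro t ht
    have h1 := hlt t ht
    rw [hu, hu]
    push_cast
    have h2 : 0 < T + 1 - (t + 1) := by linarith
    gcongr
    linarith
  have he0 : ∀ t : ℕ, t ≤ k → 0 ≤ e t := by
    intro t ht
    have h1 := hlt t ht
    have h2 : 0 ≤ T - t := by linarith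
    rw [he]
    positivity
  have heη : ∀ t : ℕ, e t ≤ η := by
    intro t
    rw [he]
    have : (T - t) / T ≤ 1 := by
      rw [div_le_one hT0]
      have : (0 : ℝ) ≤ t := by positivity
      linarith
    nlinarith
  have hβe : ∀ t : ℕ, β * e t ≤ 3 / 13 := fun t =>
    (mul_le_mul_of_nonneg_left (heη t) hβ.le).trans hβη
  have hf0 : ∀ m x, 0 ≤ f m x := fun m x => by
    have := (hfreal m).2 x
    rwa [(hfreal m).1] at this
  have htf0 : ∀ t m x, 0 ≤ tf t m x := fun t m x => by
    have := (htfreal t m).2 x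
    rwa [(htfreal t m).1] at this
  have hs1 : ∀ t m x, tf t m x ≤ f m x := fun t m x => by
    have := (hsand t m x).1
    rwa [(hfreal m).1, (htfreal t m).1, sub_zero, sub_zero] at this
  have hs2 : ∀ t m x, f m x ≤ (1 + β * e t.1) * tf t m x := fun t m x => by
    have h1 := (hsand t m x).2
    rw [(hfreal m).1, (htfreal t m).1, sub_zero, sub_zero] at h1
    have h2 := hνη t
    rw [hηe] at h2
    have h3 := mul_le_mul_of_nonneg_right (mul_le_mul_of_nonneg_right h2 hβ.le) (htf0 t m x)
    nlinarith
  obtain ⟨F, hF⟩ : ∃ F : EuclideanSpace ℝ (Fin d) → ℝ, ∀ x, F x = (1 / (M : ℝ)) * ∑ m, f m x :=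
    ⟨_, fun _ => rfl⟩
  have hF0 : ∀ x, 0 ≤ F x := fun x => by
    rw [hF]
    exact mul_nonneg (by positivity) (Finset.sum_nonneg fun m _ => hf0 m x)
  have hFs : F wstar = 0 := by
    rw [hF, Finset.sum_eq_zero (fun m _ => (hfreal m).1), mul_zero]
  have hFconv : ConvexOn ℝ Set.univ F := by
    refine ⟨convex_univ, ?_⟩
    intro x _ y _ p q hp hq hpq
    simp only [hF, smul_eq_mul]
    have h1 : ∑ m, f m (p • x + q • y) ≤ ∑ m, (p * f m x + q * f m y) :=
      Finset.sum_le_sum fun m _ =>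
        (hfconv m).2 (Set.mem_univ x) (Set.mem_univ y) hp hq hpq
    rw [Finset.sum_add_distrib, ← Finset.mul_sum, ← Finset.mul_sum] at h1
    have h2 := mul_le_mul_of_nonneg_left h1 (show 0 ≤ 1 / (M : ℝ) by positivity)
    linarith
  let Z : (Fin k → Fin M) → ℕ → EuclideanSpace ℝ (Fin d) := fun τ => sgdauxZ u wstar (w τ)
  -- independence of the future
  have hwind : ∀ (t : Fin k) (τ : Fin k → Fin M) (m : Fin M) (s : ℕ), s ≤ t.1 →
      w (Function.update τ t m) s = w τ s := by
    intro t τ m s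
    induction s with
    | zero => intro _; rw [hw0, hw0]
    | succ s ih =>
      intro hs
      have hsk : s < k := by have := t.2; omega
      have h1 := hwt (Function.update τ t m) ⟨s, hsk⟩
      have h2 := hwt τ ⟨s, hsk⟩
      have hne : (⟨s, hsk⟩ : Fin k) ≠ t := by
        intro h
        have : s = t.1 := congrArg Fin.val h
        omega
      simp only at h1 h2
      rw [h1, h2, ih (by omega), Function.update_of_ne hne]
  have hZind : ∀ (t : Fin k) (τ : Fin k → Fin M) (m : Fin M),
      Z (Function.update τ t m) (t.1 + 1) = Z τ (t.1 + 1) := by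
    intro t τ m
    exact sgdauxZ_congr _ _ _ _ _ (fun s hs => hwind t τ m s (by omega))
  let R : ℕ → ℝ := fun t => ∑ τ, u t ^ 2 * ‖w τ t - Z τ t‖ ^ 2
  let B : ℕ → ℝ := fun t => ∑ τ, u t * F (Z τ t)
  let a : ℕ → ℝ := fun t => ∑ τ, F (w τ t)
  have ha : ∀ t, 0 ≤ a t := fun t => Finset.sum_nonneg fun τ _ => hF0 _
  have hB0 : B 0 = 0 := by
    apply Finset.sum_eq_zero
    intro τ _
    show u 0 * F wstar = 0
    rw [hFs, mul_zero]
  have hR0 : R 0 = u 0 ^ 2 * ((M : ℝ) ^ k * ‖w0 - wstar‖ ^ 2) := by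
    have : ∀ τ : Fin k → Fin M, u 0 ^ 2 * ‖w τ 0 - Z τ 0‖ ^ 2 = u 0 ^ 2 * ‖w0 - wstar‖ ^ 2 := by
      intro τ
      rw [hw0]
      rfl
    simp only [R, this, Finset.sum_const, Finset.card_univ, Fintype.card_fun, Fintype.card_fin,
      nsmul_eq_mul, Nat.cast_pow]
    ring
  have hB : ∀ t, t ≤ k → B (t + 1) ≤ B t + (u (t + 1) - u t) * a t := by
    intro t ht
    simp only [B, a]
    rw [Finset.mul_sum, ← Finset.sum_add_distrib]
    apply Finset.sum_le_sum
    intro τ _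
    exact sgdauxZ_convex hFconv u wstar (w τ) t (hupos _ (by omega)) (hupos _ (by omega)).le
      (humono t ht)
  have hR : ∀ t, t < k →
      R (t + 1) ≤ R t - 2 * u (t + 1) * e t * (u (t + 1) * c t * a t - B (t + 1)) := by
    intro t ht
    let s : Fin k := ⟨t, ht⟩
    have het := he0 t ht.le
    have hbe := hβe t
    have hbe0 : 0 ≤ β * e t := mul_nonneg hβ.le het
    have hupt := hupos (t + 1) (by omega)
    have h1 : ∀ τ : Fin k → Fin M, u (t + 1) ^ 2 * ‖w τ (t + 1) - Z τ (t + 1)‖ ^ 2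
        ≤ u t ^ 2 * ‖w τ t - Z τ t‖ ^ 2
          - 2 * u (t + 1) ^ 2 * e t * ((1 - β * e t) * tf s (τ s) (w τ t)
            - tf s (τ s) (Z τ (t + 1))) := by
      intro τ
      have i1 := sgdaux_step (htfdiff s (τ s)) (htfconv s (τ s)) hβ (htfsmooth s (τ s))
        (htf0 s (τ s)) (e t) het (w τ t) (Z τ (t + 1))
      have i2 : w τ (t + 1) = w τ t - e t • gradient (tf s (τ s)) (w τ t) := by
        have := hwt τ s
        rw [hηe] at this
        exact this
      rw [← i2] at i1
      have i3 := sgdauxZ_sub u wstar (w τ) t hupt (hupos t (by omega)).le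
      have i4 := mul_le_mul_of_nonneg_left i1 (sq_nonneg (u (t + 1)))
      have i5 : u (t + 1) ^ 2 * ‖w τ t - Z τ (t + 1)‖ ^ 2 = u t ^ 2 * ‖w τ t - Z τ t‖ ^ 2 := i3
      rw [mul_sub, i5] at i4
      linarith
    have h2 := Finset.sum_le_sum (s := Finset.univ) (fun τ _ => h1 τ)
    simp only [Finset.sum_sub_distrib, ← Finset.mul_sum] at h2
    have h3 := sgdaux_indep hM s (fun τ => w τ t) (fun τ m => hwind s τ m t le_rfl)
      (fun m x => tf s m x)
    have h4 := sgdaux_indep hM s (fun τ => Z τ (t + 1)) (fun τ m => hZind s τ m)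
      (fun m x => tf s m x)
    have h5 : a t ≤ (1 + β * e t) * ∑ τ : Fin k → Fin M, tf s (τ s) (w τ t) := by
      rw [h3, Finset.mul_sum]
      apply Finset.sum_le_sum
      intro τ _
      rw [hF, mul_left_comm, Finset.mul_sum (a := 1 + β * e t)]
      exact mul_le_mul_of_nonneg_left (Finset.sum_le_sum fun m _ => hs2 s m _) (by positivity)
    have h6 : u (t + 1) * ∑ τ : Fin k → Fin M, tf s (τ s) (Z τ (t + 1)) ≤ B (t + 1) := by
      rw [h4]
      simp only [B]
      rw [Finset.mul_sum]
      apply Finset.sum_le_sum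
      intro τ _
      rw [hF]
      exact mul_le_mul_of_nonneg_left (mul_le_mul_of_nonneg_left
        (Finset.sum_le_sum fun m _ => hs1 s m _) (by positivity)) hupt.le
    have h7 : c t * a t ≤ (1 - β * e t) * ∑ τ : Fin k → Fin M, tf s (τ s) (w τ t) := by
      have hpos : 0 < 1 + β * e t := by linarith
      have hcn : 0 ≤ c t := by rw [hc]; exact div_nonneg (by linarith) hpos.le
      refine (mul_le_mul_of_nonneg_left h5 hcn).trans (le_of_eq ?_)
      rw [hc]
      field_simp
    have h8 := mul_le_mul_of_nonneg_left h7 hupt.le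
    have h9 : 0 ≤ 2 * u (t + 1) * e t := by positivity
    have h10 : u (t + 1) * c t * a t - B (t + 1)
        ≤ u (t + 1) * ((1 - β * e t) * ∑ τ : Fin k → Fin M, tf s (τ s) (w τ t))
          - u (t + 1) * ∑ τ : Fin k → Fin M, tf s (τ s) (Z τ (t + 1)) := by
      linarith
    have h11 := mul_le_mul_of_nonneg_left h10 h9
    have hRt : ∀ i, R i = u i ^ 2 * ∑ τ, ‖w τ i - Z τ i‖ ^ 2 := fun i =>
      (Finset.mul_sum _ _ _).symm
    rw [hRt, hRt]
    linarith
  have hlast : 0 ≤ R k - 2 * u (k + 1) * e k * (u (k + 1) * c k * a k - B (k + 1)) := by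
    have het := he0 k le_rfl
    have hbe := hβe k
    have hbe0 : 0 ≤ β * e k := mul_nonneg hβ.le het
    have hupt := hupos (k + 1) le_rfl
    have hck : c k ≤ 1 - β * e k := by
      rw [hc, div_le_iff₀ (by linarith)]
      nlinarith
    have h1 : ∀ τ : Fin k → Fin M, 0 ≤ u k ^ 2 * ‖w τ k - Z τ k‖ ^ 2
          - 2 * u (k + 1) * e k * (u (k + 1) * c k * F (w τ k)
            - u (k + 1) * F (Z τ (k + 1))) := by
      intro τ
      have i0 : ∀ m, 0 ≤ ‖w τ k - Z τ (k + 1)‖ ^ 2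
          - 2 * e k * ((1 - β * e k) * f m (w τ k) - f m (Z τ (k + 1))) := fun m =>
        (sq_nonneg _).trans (sgdaux_step (hfdiff m) (hfconv m) hβ (hfsmooth m)
        (hf0 m) (e k) het (w τ k) (Z τ (k + 1)))
      have i1 := Finset.sum_nonneg (s := Finset.univ) (fun m _ => i0 m)
      rw [Finset.sum_sub_distrib, ← Finset.mul_sum, Finset.sum_sub_distrib, ← Finset.mul_sum] at i1
      simp only [Finset.sum_const, Finset.card_univ, Fintype.card_fin, nsmul_eq_mul] at i1
      have i2 : ∀ x, ∑ m, f m x = M * F x := by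
        intro x
        rw [hF]
        field_simp
      rw [i2, i2] at i1
      have i3 : 0 ≤ ‖w τ k - Z τ (k + 1)‖ ^ 2
          - 2 * e k * ((1 - β * e k) * F (w τ k) - F (Z τ (k + 1))) := by
        have : 0 ≤ (M : ℝ) * (‖w τ k - Z τ (k + 1)‖ ^ 2
          - 2 * e k * ((1 - β * e k) * F (w τ k) - F (Z τ (k + 1)))) := by linarith
        exact nonneg_of_mul_nonneg_right this hM0
      have i4 := mul_le_mul_of_nonneg_right hck (hF0 (w τ k))
      have i5 : 0 ≤ ‖w τ k - Z τ (k + 1)‖ ^ 2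
          - 2 * e k * (c k * F (w τ k) - F (Z τ (k + 1))) := by
        have := mul_le_mul_of_nonneg_left i4 het
        linarith
      have i6 : u (k + 1) ^ 2 * ‖w τ k - Z τ (k + 1)‖ ^ 2 = u k ^ 2 * ‖w τ k - Z τ k‖ ^ 2 :=
        sgdauxZ_sub u wstar (w τ) k hupt (hupos k (by omega)).le
      have i7 := mul_nonneg (sq_nonneg (u (k + 1))) i5
      rw [mul_sub, i6] at i7
      linarith
    have h2 := Finset.sum_nonneg (s := Finset.univ) (fun τ _ => h1 τ)
    simp only [Finset.sum_sub_distrib, ← Finset.mul_sum] at h2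
    simp only [R, B, a, ← Finset.mul_sum]
    exact h2
  have hfin := sgdaux_recursion k hk β η T hT hβ hηpos hβη u e c R B a
    ((M : ℝ) ^ k * ‖w0 - wstar‖ ^ 2) hu he hc ha hB0 (by positivity) hR0 hB hR hlast
  have hgoal : (∑ τ : Fin k → Fin M,
        ((1 / (M : ℝ)) * ∑ m, f m (w τ k) - (1 / (M : ℝ)) * ∑ m, f m wstar))
        / (M : ℝ) ^ k
      ≤ 9 * ‖w0 - wstar‖ ^ 2 / (2 * η * ((k : ℝ) + 1)) := by
    have h1 : (∑ τ : Fin k → Fin M,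
        ((1 / (M : ℝ)) * ∑ m, f m (w τ k) - (1 / (M : ℝ)) * ∑ m, f m wstar)) = a k := by
      apply Finset.sum_congr rfl
      intro τ _
      rw [← hF, ← hF, hFs, sub_zero]
    rw [h1, div_le_iff₀ (by positivity), ← hT]
    refine hfin.trans (le_of_eq ?_)
    field_simp
  refine ⟨hgoal, fun hη => hgoal.trans ?_⟩
  rw [div_le_div_iff₀ (by positivity) (by positivity)]
  have hyβ : β * η = 3 / 13 := by rw [hη]; field_simp
  have h3 : 20 * β * ‖w0 - wstar‖ ^ 2 * (2 * η * ((k : ℝ) + 1))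
      = 40 * (β * η) * (‖w0 - wstar‖ ^ 2 * ((k : ℝ) + 1)) := by ring
  rw [h3, hyβ]
  have : 0 ≤ ‖w0 - wstar‖ ^ 2 * ((k : ℝ) + 1) := by positivity
  linarith
end
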